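/- Assume ρ ∈ (0,1) and σx < σy. Then for every a = (x1, y1) ∈ ℝ² with x1² + y1² > 2c², one has K(a, b*) > 0. -/

import Mathlib

open MeasureTheory ProbabilityTheory Real

/-- The bivariate normal measure on ℝ × ℝ with mean (0,0), standard deviations
`sx, sy` and correlation `ρ`, realized as the pushforward of two independent
standard gaussians. -/
noncomputable def binormal (sx sy ρ : ℝ) : Measure (ℝ × ℝ) :=
  Measure.map (fun z : ℝ × ℝ => (sx * z.1, sy * (ρ * z.1 + Real.sqrt (1 - ρ ^ 2) * z.2)))
    ((gaussianReal 0 1).prod (gaussianReal 0 1))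

/-- The set of points strictly closer (in Euclidean distance) to `a` than to `b`. -/
def closerTo (a b : ℝ × ℝ) : Set (ℝ × ℝ) :=
  {p | (p.1 - a.1) ^ 2 + (p.2 - a.2) ^ 2 < (p.1 - b.1) ^ 2 + (p.2 - b.2) ^ 2}

/-- The expected payoff (from Player I to Player II) when Player I offers `a`
and Player II offers `b`. -/
noncomputable def K (sx sy ρ : ℝ) (a b : ℝ × ℝ) : ℝ :=
  if a = b then a.1 + a.2
  else (a.1 + a.2) * ((binormal sx sy ρ) (closerTo a b)).toReal
    + (b.1 + b.2) * ((binormal sx sy ρ) (closerTo b a)).toReal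

/-- The common optimal offer magnitude. -/
noncomputable def cstar (sx sy ρ : ℝ) : ℝ :=
  Real.sqrt (2 * Real.pi * (sx ^ 2 + 2 * ρ * sx * sy + sy ^ 2)) / 4

/-- The standard normal law is the law of every unit-norm combination of two independent standard
normal variables. -/
lemma map_combination_gaussianReal_prod {α β : ℝ} (h : α ^ 2 + β ^ 2 = 1) :
    ((gaussianReal 0 1).prod (gaussianReal 0 1)).map (fun z : ℝ × ℝ => α * z.1 + β * z.2) =
      gaussianReal 0 1 := by
  have hX : HasLaw (fun z : ℝ × ℝ => α * z.1) (gaussianReal (α * 0) (.mk (α ^ 2) (sq_nonneg _) * 1))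
      ((gaussianReal 0 1).prod (gaussianReal 0 1)) :=
    gaussianReal_const_mul ⟨by fun_prop, Measure.fst_prod⟩ α
  have hY : HasLaw (fun z : ℝ × ℝ => β * z.2) (gaussianReal (β * 0) (.mk (β ^ 2) (sq_nonneg _) * 1))
      ((gaussianReal 0 1).prod (gaussianReal 0 1)) :=
    gaussianReal_const_mul ⟨by fun_prop, Measure.snd_prod⟩ β
  have hXY : IndepFun (fun z : ℝ × ℝ => α * z.1) (fun z : ℝ × ℝ => β * z.2)
      ((gaussianReal 0 1).prod (gaussianReal 0 1)) :=
    indepFun_prod (X := fun x : ℝ => α * x) (Y := fun x : ℝ => β * x) (by fun_prop) (by fun_prop)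
  have key := gaussianReal_add_gaussianReal_of_indepFun hXY hX.map_eq hY.map_eq
  have hv : (NNReal.mk (α ^ 2) (sq_nonneg _) * 1 + NNReal.mk (β ^ 2) (sq_nonneg _) * 1) = 1 := by
    ext
    simpa using h
  rw [hv] at key
  simpa [Pi.add_def] using key

lemma gaussianPDFReal_zero_one (x : ℝ) :
    gaussianPDFReal 0 1 x = (√(2 * π))⁻¹ * rexp (-x ^ 2 / 2) := by
  simp [gaussianPDFReal_def]

lemma gaussianReal_real_eq_integral (s : Set ℝ) :
    (gaussianReal 0 1).real s = ∫ x in s, gaussianPDFReal 0 1 x := by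
  rw [Measure.real, gaussianReal_apply_eq_integral _ one_ne_zero, ENNReal.toReal_ofReal]
  exact integral_nonneg fun x => gaussianPDFReal_nonneg _ _ _

lemma gaussianReal_real_Iio (t : ℝ) :
    (gaussianReal 0 1).real (Set.Iio t) = 1 - (gaussianReal 0 1).real (Set.Ioi t) := by
  have : NullSingletonClass (gaussianReal 0 1) := nullSingletonClass_gaussianReal one_ne_zero
  rw [measureReal_congr (Iio_ae_eq_Iic (μ := gaussianReal 0 1)), ← Set.compl_Ioi,
    probReal_compl_eq_one_sub measurableSet_Ioi]

lemma gaussianReal_real_Ioi_zero : (gaussianReal 0 1).real (Set.Ioi 0) = 1 / 2 := by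
  have h1 : (gaussianReal 0 1).real (Set.Iio 0) = (gaussianReal 0 1).real (Set.Ioi 0) := by
    have h := gaussianReal_map_neg (μ := 0) (v := 1)
    rw [neg_zero] at h
    conv_lhs => rw [← h]
    rw [map_measureReal_apply (by fun_prop) measurableSet_Iio]
    congr 1
    ext x
    simp
  have h2 := gaussianReal_real_Iio 0
  linarith

/-- Taylor bound for the gaussian tail, from `1 - x ^ 2 / 2 ≤ exp (-x ^ 2 / 2)`. -/
lemma gaussianReal_real_Ioi_le_half_sub {t : ℝ} (ht : 0 ≤ t) :
    (gaussianReal 0 1).real (Set.Ioi t) ≤ 1 / 2 - (√(2 * π))⁻¹ * (t - t ^ 3 / 6) := by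
  have hsplit : (gaussianReal 0 1).real (Set.Ioi 0) =
      (gaussianReal 0 1).real (Set.Ioc 0 t) + (gaussianReal 0 1).real (Set.Ioi t) := by
    rw [← measureReal_union (Set.Ioc_disjoint_Ioi le_rfl) measurableSet_Ioi,
      Set.Ioc_union_Ioi_eq_Ioi ht]
  have hpoly : ∫ x in (0 : ℝ)..t, (√(2 * π))⁻¹ * (1 - x ^ 2 / 2) =
      (√(2 * π))⁻¹ * (t - t ^ 3 / 6) := by
    rw [intervalIntegral.integral_const_mul, intervalIntegral.integral_sub (by simp)
      (Continuous.intervalIntegrable (by fun_prop) _ _)]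
    simp
    left
    ring
  have hle : ∫ x in (0 : ℝ)..t, (√(2 * π))⁻¹ * (1 - x ^ 2 / 2) ≤
      ∫ x in (0 : ℝ)..t, gaussianPDFReal 0 1 x := by
    refine intervalIntegral.integral_mono_on ht (Continuous.intervalIntegrable (by fun_prop) _ _)
      (integrable_gaussianPDFReal 0 1).intervalIntegrable fun x _ => ?_
    rw [gaussianPDFReal_zero_one]
    gcongr
    have := add_one_le_exp (-x ^ 2 / 2)
    linarith
  rw [intervalIntegral.integral_of_le ht (f := gaussianPDFReal 0 1),
    ← gaussianReal_real_eq_integral, hpoly] at hle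
  rw [gaussianReal_real_Ioi_zero] at hsplit
  linarith

/-- The Mills ratio upper bound for the gaussian tail. -/
lemma gaussianReal_real_Ioi_le_mills {t : ℝ} (ht : 0 < t) :
    (gaussianReal 0 1).real (Set.Ioi t) ≤ (√(2 * π))⁻¹ * (rexp (-t ^ 2 / 2) / t) := by
  have hint : Integrable fun x : ℝ => x * rexp (-x ^ 2 / 2) := by
    convert! integrable_mul_exp_neg_mul_sq (b := 1 / 2) (by norm_num) using 4
    ring
  have hval : ∫ x in Set.Ioi t, x * rexp (-x ^ 2 / 2) = rexp (-t ^ 2 / 2) := by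
    have hderiv : ∀ x ∈ Set.Ici t,
        HasDerivAt (fun x : ℝ => -rexp (-x ^ 2 / 2)) (x * rexp (-x ^ 2 / 2)) x := by
      intro x _
      convert! ((((hasDerivAt_id x).pow 2).neg.div_const 2).exp.neg) using 1
      simp
      ring
    have hlim : Filter.Tendsto (fun x : ℝ => -rexp (-x ^ 2 / 2)) Filter.atTop (nhds 0) := by
      rw [← neg_zero]
      refine (tendsto_exp_atBot.comp ?_).neg
      have : (fun x : ℝ => -x ^ 2 / 2) = fun x : ℝ => -(x ^ 2 / 2) := by
        ext x
        ring
      rw [this]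
      exact Filter.tendsto_neg_atTop_atBot.comp
        ((Filter.tendsto_pow_atTop two_ne_zero).atTop_div_const two_pos)
    rw [integral_Ioi_of_hasDerivAt_of_tendsto' hderiv hint.integrableOn hlim]
    ring
  have hle : ∫ x in Set.Ioi t, gaussianPDFReal 0 1 x ≤
      ∫ x in Set.Ioi t, ((√(2 * π))⁻¹ / t) * (x * rexp (-x ^ 2 / 2)) := by
    refine setIntegral_mono_on (integrable_gaussianPDFReal 0 1).integrableOn
      (hint.const_mul _).integrableOn measurableSet_Ioi fun x hx => ?_
    rw [gaussianPDFReal_zero_one]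
    have hx : 1 ≤ x / t := (one_le_div ht).2 (le_of_lt hx)
    calc (√(2 * π))⁻¹ * rexp (-x ^ 2 / 2) ≤ (√(2 * π))⁻¹ * rexp (-x ^ 2 / 2) * (x / t) :=
          le_mul_of_one_le_right (by positivity) hx
      _ = _ := by ring
  rw [integral_const_mul, hval, ← gaussianReal_real_eq_integral] at hle
  exact hle.trans_eq (by ring)

/-- A rational bound for the gaussian tail, sharp to first order at `0`. -/
lemma gaussianReal_real_Ioi_lt_rational {τ : ℝ} (hτ : 0 < τ) :
    (gaussianReal 0 1).real (Set.Ioi (√(2 * π) * τ / 2)) <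
      (2 + 2 * τ) / (4 + 8 * τ + 5 * τ ^ 2) := by
  have hπ := pi_gt_three
  have hπ' := pi_lt_d2
  have hk : 0 < √(2 * π) := by positivity
  have hk2 : √(2 * π) ^ 2 = 2 * π := sq_sqrt (by positivity)
  rcases le_or_gt τ 1 with h1 | h1
  · refine (gaussianReal_real_Ioi_le_half_sub (by positivity)).trans_lt ?_
    have : (√(2 * π))⁻¹ * (√(2 * π) * τ / 2 - (√(2 * π) * τ / 2) ^ 3 / 6) =
        τ / 2 - π * τ ^ 3 / 24 := by
      field_simp
      rw [hk2]
      ring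
    rw [this, lt_div_iff₀ (by positivity)]
    have h2 : π * τ ^ 3 / 24 ≤ 3.15 * τ ^ 3 / 24 := by gcongr
    have h3 : τ ^ 3 ≤ τ ^ 2 := pow_le_pow_of_le_one hτ.le h1 (by norm_num)
    have h4 : τ ^ 4 ≤ τ ^ 2 := pow_le_pow_of_le_one hτ.le h1 (by norm_num)
    have h5 : τ ^ 5 ≤ τ ^ 2 := pow_le_pow_of_le_one hτ.le h1 (by norm_num)
    have h6 : 0 < τ ^ 2 := by positivity
    have h7 : 0 < τ ^ 3 := by positivity
    calc (1 / 2 - (τ / 2 - π * τ ^ 3 / 24)) * (4 + 8 * τ + 5 * τ ^ 2)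
        ≤ (1 / 2 - (τ / 2 - 3.15 * τ ^ 3 / 24)) * (4 + 8 * τ + 5 * τ ^ 2) := by gcongr
      _ < 2 + 2 * τ := by nlinarith
  · refine (gaussianReal_real_Ioi_le_mills (by positivity)).trans_lt ?_
    have hexp : rexp (-(√(2 * π) * τ / 2) ^ 2 / 2) ≤ 1 / (1 + 3 * τ ^ 2 / 4) := by
      rw [show -(√(2 * π) * τ / 2) ^ 2 / 2 = -(π * τ ^ 2 / 4) by
        rw [div_pow, mul_pow, hk2]; ring, exp_neg, ← one_div]
      have h2 := add_one_le_exp (π * τ ^ 2 / 4)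
      have h3 : 3 * τ ^ 2 / 4 ≤ π * τ ^ 2 / 4 := by gcongr
      gcongr
      linarith
    calc (√(2 * π))⁻¹ * (rexp (-(√(2 * π) * τ / 2) ^ 2 / 2) / (√(2 * π) * τ / 2))
        = rexp (-(√(2 * π) * τ / 2) ^ 2 / 2) / (π * τ) := by
          rw [show π * τ = √(2 * π) ^ 2 * τ / 2 by rw [hk2]; ring]
          field_simp
      _ ≤ (1 / (1 + 3 * τ ^ 2 / 4)) / (3 * τ) := by gcongr
      _ < _ := by
          rw [div_div, div_lt_div_iff₀ (by positivity) (by positivity)]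
          have h2 : 1 < τ ^ 2 := one_lt_pow₀ h1 two_ne_zero
          have h3 : τ < τ ^ 3 := lt_self_pow₀ h1 (by norm_num)
          have h4 : τ ^ 2 < τ ^ 4 := pow_lt_pow_right₀ h1 (by norm_num)
          nlinarith

/-- If the bisector parameter `τ` is large enough relative to the excess `h`, then the rational
tail bound is at most `1 / (2 + h)`. -/
lemma rational_tail_le {τ h : ℝ} (hτ : 0 < τ) (hh : 0 ≤ h)
    (hq : h * (2 + h) ≤ τ ^ 2 + 2 * (2 + h) * τ) :
    (2 + 2 * τ) / (4 + 8 * τ + 5 * τ ^ 2) ≤ 1 / (2 + h) := by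
  have hbound : h * (2 * (1 + τ)) ≤ 4 * τ * (1 + τ) + τ ^ 2 := by
    by_contra! hcon
    have hτ1 : 0 < 1 + τ := by linarith
    have hhτ : 2 * τ * (2 * (1 + τ)) ≤ h * (2 * (1 + τ)) := by nlinarith
    have h2τ : 2 * τ ≤ h := le_of_mul_le_mul_right hhτ (by linarith)
    nlinarith [mul_nonneg hτ.le hτ.le, sq_nonneg (τ ^ 2), mul_pos hτ hτ1]
  rw [div_le_div_iff₀ (by positivity) (by positivity)]
  nlinarith

/-- The half-plane of points closer to `a` than to `b` has gaussian tail probability. -/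
lemma binormal_real_closerTo {sx sy ρ s : ℝ} (hρ : ρ ^ 2 ≤ 1) (a b : ℝ × ℝ) (hs : 0 < s)
    (hs2 : s ^ 2 = sx ^ 2 * (a.1 - b.1) ^ 2 + 2 * ρ * sx * sy * (a.1 - b.1) * (a.2 - b.2)
      + sy ^ 2 * (a.2 - b.2) ^ 2) :
    (binormal sx sy ρ).real (closerTo a b) = (gaussianReal 0 1).real
      (Set.Ioi ((a.1 ^ 2 + a.2 ^ 2 - b.1 ^ 2 - b.2 ^ 2) / (2 * s))) := by
  have hr : √(1 - ρ ^ 2) ^ 2 = 1 - ρ ^ 2 := sq_sqrt (by linarith)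
  have hunit : ((sx * (a.1 - b.1) + sy * ρ * (a.2 - b.2)) / s) ^ 2 +
      ((sy * √(1 - ρ ^ 2) * (a.2 - b.2)) / s) ^ 2 = 1 := by
    rw [div_pow, div_pow, ← add_div, div_eq_one_iff_eq (by positivity), hs2, mul_pow, mul_pow, hr]
    ring
  have hmeas : MeasurableSet (closerTo a b) :=
    measurableSet_lt (by fun_prop) (by fun_prop)
  rw [← map_combination_gaussianReal_prod hunit, binormal,
    map_measureReal_apply (by fun_prop) hmeas, map_measureReal_apply (by fun_prop) measurableSet_Ioi]
  congr 1
  ext z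
  simp only [closerTo, Set.mem_preimage, Set.mem_ofPred_eq, Set.mem_Ioi]
  rw [div_lt_iff₀ (by positivity)]
  have : ((sx * (a.1 - b.1) + sy * ρ * (a.2 - b.2)) / s * z.1 +
      sy * √(1 - ρ ^ 2) * (a.2 - b.2) / s * z.2) * (2 * s) =
      2 * ((sx * z.1) * (a.1 - b.1) +
        (sy * (ρ * z.1 + √(1 - ρ ^ 2) * z.2)) * (a.2 - b.2)) := by
    field_simp
    ring
  rw [this]
  constructor <;> intro h <;> linarith

/-- With `t` the distance from the mean to the bisector, in standard deviations, the payoff is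
determined by the gaussian tail at `t`. -/
lemma K_eq_tail {sx sy ρ s : ℝ} (hρ : ρ ^ 2 ≤ 1) (a b : ℝ × ℝ) (hab : a ≠ b) (hs : 0 < s)
    (hs2 : s ^ 2 = sx ^ 2 * (a.1 - b.1) ^ 2 + 2 * ρ * sx * sy * (a.1 - b.1) * (a.2 - b.2)
      + sy ^ 2 * (a.2 - b.2) ^ 2) {p : ℝ} (hp : p = (gaussianReal 0 1).real
      (Set.Ioi ((a.1 ^ 2 + a.2 ^ 2 - b.1 ^ 2 - b.2 ^ 2) / (2 * s)))) :
    K sx sy ρ a b = (a.1 + a.2) * p + (b.1 + b.2) * (1 - p) := by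
  have h1 := binormal_real_closerTo hρ a b hs hs2
  have h2 := binormal_real_closerTo (sx := sx) (sy := sy) hρ b a hs (by rw [hs2]; ring)
  have hsymm : ∀ t : ℝ, (gaussianReal 0 1).real (Set.Ioi (-t)) =
      1 - (gaussianReal 0 1).real (Set.Ioi t) := by
    intro t
    rw [← gaussianReal_real_Iio]
    have h := gaussianReal_map_neg (μ := 0) (v := 1)
    rw [neg_zero] at h
    conv_lhs => rw [← h]
    rw [map_measureReal_apply (by fun_prop) measurableSet_Ioi]
    congr 1
    ext x
    simp
  rw [show (b.1 ^ 2 + b.2 ^ 2 - a.1 ^ 2 - a.2 ^ 2) / (2 * s) =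
    -((a.1 ^ 2 + a.2 ^ 2 - b.1 ^ 2 - b.2 ^ 2) / (2 * s)) by ring, hsymm, ← hp] at h2
  rw [← hp] at h1
  rw [K, if_neg hab]
  simp only [Measure.real] at h1 h2
  rw [h1, h2]

/-- The covariance form is positive definite. -/
lemma quadratic_form_pos {sx sy ρ u v : ℝ} (hsx : 0 < sx) (hsy : 0 < sy) (hρ : ρ ^ 2 < 1)
    (huv : u ≠ 0 ∨ v ≠ 0) : 0 < sx ^ 2 * u ^ 2 + 2 * ρ * sx * sy * u * v + sy ^ 2 * v ^ 2 := by
  have heq : sx ^ 2 * u ^ 2 + 2 * ρ * sx * sy * u * v + sy ^ 2 * v ^ 2 =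
      (sx * u + ρ * sy * v) ^ 2 + (1 - ρ ^ 2) * (sy * v) ^ 2 := by ring
  have hcoef : 0 < 1 - ρ ^ 2 := by linarith
  rw [heq]
  rcases eq_or_ne v 0 with rfl | hv
  · have hu : u ≠ 0 := by simpa using huv
    simp only [mul_zero, add_zero]
    positivity
  · positivity

/-- In the coordinates along and across the diagonal, the covariance form is dominated by its
value on the diagonal. -/
lemma quadratic_form_le {sx sy ρ q : ℝ} (hsx : 0 ≤ sx) (hρ : 0 ≤ ρ) (hσ : sx ≤ sy) (hq : 0 ≤ q)
    (ε : ℝ) :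
    sx ^ 2 * (ε - q) ^ 2 + 2 * ρ * sx * sy * (ε - q) * (-ε - q) + sy ^ 2 * (-ε - q) ^ 2 ≤
      (sx ^ 2 + 2 * ρ * sx * sy + sy ^ 2) * (q + |ε|) ^ 2 := by
  have hsy : 0 ≤ sy := hsx.trans hσ
  have hpos : 0 ≤ ρ * sx * sy := by positivity
  have hD : 0 ≤ sy ^ 2 - sx ^ 2 := sub_nonneg.2 (pow_le_pow_left₀ hsx hσ 2)
  have h1 := mul_nonneg hpos (sq_nonneg |ε|)
  have h2 : 0 ≤ (sy ^ 2 - sx ^ 2) * (q * (|ε| - ε)) :=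
    mul_nonneg hD (mul_nonneg hq (sub_nonneg.2 (le_abs_self ε)))
  have h3 : 0 ≤ (sx ^ 2 + ρ * sx * sy) * (q * |ε|) := by positivity
  have habs := sq_abs ε
  linear_combination 4 * h1 + 2 * h2 + 4 * h3 -
    (sx ^ 2 - 2 * ρ * sx * sy + sy ^ 2) * habs

theorem positive_outside_circle (sx sy ρ : ℝ) (hsx : 0 < sx) (hsy : 0 < sy)
    (hρ : ρ ∈ Set.Ioo (0 : ℝ) 1) (hσ : sx < sy) (a : ℝ × ℝ)
    (ha : a.1 ^ 2 + a.2 ^ 2 > 2 * (cstar sx sy ρ) ^ 2) :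
    0 < K sx sy ρ a ((cstar sx sy ρ, cstar sx sy ρ) : ℝ × ℝ) := by
  obtain ⟨hρ0, hρ1⟩ := hρ
  have hρ2 : ρ ^ 2 < 1 := by nlinarith
  have hV : 0 < sx ^ 2 + 2 * ρ * sx * sy + sy ^ 2 := by positivity
  set V := sx ^ 2 + 2 * ρ * sx * sy + sy ^ 2 with hVdef
  have hk : 0 < √(2 * π) := by positivity
  have hk2 : √(2 * π) ^ 2 = 2 * π := sq_sqrt (by positivity)
  have hS : 0 < √V := by positivity
  have hS2 : √V ^ 2 = V := sq_sqrt hV.le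
  have hc4 : 4 * cstar sx sy ρ = √(2 * π) * √V := by
    rw [cstar, ← hVdef, sqrt_mul (by positivity)]
    ring
  set c := cstar sx sy ρ
  set k := √(2 * π)
  set S := √V
  have hc : 0 < c := by nlinarith [mul_pos hk hS]
  obtain ⟨x, y⟩ := a
  simp only at ha
  set d := x ^ 2 + y ^ 2 - c ^ 2 - c ^ 2 with hd
  have hd0 : 0 < d := by linarith
  have hab : (x, y) ≠ (c, c) := by
    intro h
    obtain ⟨rfl, rfl⟩ := Prod.mk.inj h
    simp [d] at hd0
  set Q := sx ^ 2 * (x - c) ^ 2 + 2 * ρ * sx * sy * (x - c) * (y - c) + sy ^ 2 * (y - c) ^ 2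
    with hQ
  have hQpos : 0 < Q := quadratic_form_pos hsx hsy hρ2
    (by simpa [sub_eq_zero, Prod.ext_iff, imp_iff_not_or, not_and_or] using hab)
  have hs : 0 < √Q := by positivity
  have hs2 : √Q ^ 2 = Q := sq_sqrt hQpos.le
  set s := √Q
  set p := (gaussianReal 0 1).real (Set.Ioi (d / (2 * s))) with hp
  have hK : K sx sy ρ (x, y) (c, c) = (x + y) * p + (c + c) * (1 - p) :=
    K_eq_tail hρ2.le (x, y) (c, c) hab hs hs2 hp
  rw [hK]
  set τ := d / (k * s) with hτdef
  have hτ : 0 < τ := by positivity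
  have hpτ : p < (2 + 2 * τ) / (4 + 8 * τ + 5 * τ ^ 2) := by
    have := gaussianReal_real_Ioi_lt_rational hτ
    rwa [show √(2 * π) * τ / 2 = d / (2 * s) by
      change k * τ / 2 = d / (2 * s)
      rw [hτdef]; field_simp] at this
  have hp0 : 0 ≤ p := measureReal_nonneg
  suffices ∃ h : ℝ, 0 ≤ h ∧ -(2 * c * (1 + h)) ≤ x + y ∧
      h * (2 + h) ≤ τ ^ 2 + 2 * (2 + h) * τ by
    obtain ⟨h, hh, hxy, hq⟩ := this
    have h1 := hpτ.trans_le (rational_tail_le hτ hh hq)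
    rw [lt_div_iff₀ (by linarith)] at h1
    have h2 : 0 < 2 * c * (1 - p * (2 + h)) := by
      have : 0 < 1 - p * (2 + h) := by linarith
      positivity
    have h3 := mul_le_mul_of_nonneg_right hxy hp0
    linarith
  rcases le_or_gt (-(2 * c)) (x + y) with hxy | hxy
  · exact ⟨0, le_rfl, by linarith, by rw [zero_mul]; positivity⟩
  set h := -(x + y) / (2 * c) - 1 with hhdef
  have hsum : x + y = -(2 * c * (1 + h)) := by
    rw [hhdef]; field_simp; ring
  have hh : 0 < h := by
    rw [hhdef, sub_pos, lt_div_iff₀ (by positivity)]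
    linarith
  set ε := (x - y) / (2 * c) with hεdef
  have hdiff : x - y = 2 * c * ε := by rw [hεdef]; field_simp
  have hx : x = c * (ε - (1 + h)) := by linarith
  have hy : y = c * (-ε - (1 + h)) := by linarith
  have hdeq : d = 2 * c ^ 2 * (h * (2 + h) + |ε| ^ 2) := by
    rw [sq_abs, hd, hx, hy]; ring
  have hε := abs_nonneg ε
  have hsle : s ≤ S * c * ((2 + h) + |ε|) := by
    refine abs_le_of_sq_le_sq' ?_ (by positivity) |>.2
    rw [hs2, mul_pow, mul_pow, hS2]
    have hQeq : Q = c ^ 2 * (sx ^ 2 * (ε - (2 + h)) ^ 2 +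
        2 * ρ * sx * sy * (ε - (2 + h)) * (-ε - (2 + h)) + sy ^ 2 * (-ε - (2 + h)) ^ 2) := by
      rw [hQ, hx, hy]; ring
    have hform := mul_le_mul_of_nonneg_left (quadratic_form_le (q := 2 + h) hsx.le hρ0.le hσ.le
      (by linarith) ε) (sq_nonneg c)
    rw [← hVdef, ← hQeq] at hform
    exact hform.trans_eq (by ring)
  have hτge : h * (2 + h) + |ε| ^ 2 ≤ 2 * τ * ((2 + h) + |ε|) := by
    rw [hτdef, mul_div_assoc', div_mul_eq_mul_div, le_div_iff₀ (by positivity)]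
    calc (h * (2 + h) + |ε| ^ 2) * (k * s)
        ≤ (h * (2 + h) + |ε| ^ 2) * (k * (S * c * ((2 + h) + |ε|))) := by gcongr
      _ = (k * S) * (c * ((h * (2 + h) + |ε| ^ 2) * ((2 + h) + |ε|))) := by ring
      _ = 2 * d * ((2 + h) + |ε|) := by rw [← hc4, hdeq]; ring
  exact ⟨h, hh.le, hsum.ge, by nlinarith [sq_nonneg (τ - |ε|)]⟩
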